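/- arXiv:1510.07158 — 2 statements merged into one kernel-verified Lean document; each statement's English description precedes it below -/
import Mathlib

section
/- Let f : ℝ → ℝ be continuous on [0,1] and convex on [0,1], with f(0) > 0 and f(1) = 1. If there exists y ∈ (0,1) with f(y) < y, then there is exactly one x ∈ (0,1) with f(x) = x. -/
theorem ConvexOn.lt_self_of_mem_openSegment {s : Set ℝ} {f : ℝ → ℝ} (hf : ConvexOn ℝ s f)
    {p q z : ℝ} (hp : p ∈ s) (hq : q ∈ s) (hfp : f p ≤ p) (hfq : f q < q)
    (hz : z ∈ openSegment ℝ p q) : f z < z := by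
  obtain ⟨a, b, ha, hb, hab, rfl⟩ := hz
  calc f (a • p + b • q) ≤ a • f p + b • f q := hf.2 hp hq ha.le hb.le hab
    _ < a • p + b • q :=
      add_lt_add_of_le_of_lt (smul_le_smul_of_nonneg_left hfp ha.le)
        (smul_lt_smul_of_pos_left hfq hb)

/-- A function continuous and convex on `[0,1]` with `f 0 > 0`, `f 1 = 1`, which dips
strictly below the diagonal at some point of `(0,1)`, has exactly one fixed point
in `(0,1)`. -/
theorem unique_interior_fixed_point_of_dip (f : ℝ → ℝ)
    (hcont : ContinuousOn f (Set.Icc 0 1))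
    (hconv : ConvexOn ℝ (Set.Icc 0 1) f)
    (h0 : 0 < f 0) (h1 : f 1 = 1)
    (hdip : ∃ y ∈ Set.Ioo (0 : ℝ) 1, f y < y) :
    ∃! x : ℝ, x ∈ Set.Ioo (0 : ℝ) 1 ∧ f x = x := by
  obtain ⟨y, hy, hfy⟩ := hdip
  have hyI := Set.Ioo_subset_Icc_self hy
  have fixed_lt : ∀ x ∈ Set.Ioo (0 : ℝ) 1, f x = x → x < y := by
    intro x hx hfx
    by_contra! hyx
    have hlt : y < x := hyx.lt_of_ne fun h => hfy.ne (h ▸ hfx)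
    refine (hconv.lt_self_of_mem_openSegment (z := x) (Set.right_mem_Icc.2 zero_le_one) hyI
      h1.le hfy ?_).ne hfx
    rw [openSegment_symm, openSegment_eq_Ioo hy.2]
    exact ⟨hlt, hx.2⟩
  have fixed_le : ∀ a ∈ Set.Ioo (0 : ℝ) 1, f a = a → ∀ b ∈ Set.Ioo (0 : ℝ) 1, f b = b →
      b ≤ a := by
    intro a ha hfa b hb hfb
    by_contra! hab
    refine (hconv.lt_self_of_mem_openSegment (z := b) (Set.Ioo_subset_Icc_self ha) hyI
      hfa.le hfy ?_).ne hfb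
    rw [openSegment_eq_Ioo (fixed_lt a ha hfa)]
    exact ⟨hab, fixed_lt b hb hfb⟩
  have hcont' : ContinuousOn (fun x => f x - x) (Set.Icc 0 y) :=
    (hcont.mono (Set.Icc_subset_Icc_right hy.2.le)).sub continuousOn_id
  obtain ⟨x, hx, hfx⟩ := intermediate_value_Ioo' hy.1.le hcont'
    (show (0 : ℝ) ∈ Set.Ioo (f y - y) (f 0 - 0) from ⟨by linarith, by linarith⟩)
  have hxI : x ∈ Set.Ioo (0 : ℝ) 1 := ⟨hx.1, hx.2.trans hy.2⟩
  have hfx' : f x = x := sub_eq_zero.1 hfx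
  exact ⟨x, ⟨hxI, hfx'⟩, fun z hz =>
    (fixed_le x hxI hfx' z hz.1 hz.2).antisymm (fixed_le z hz.1 hz.2 x hxI hfx')⟩
end

section
/- Let B be a nonempty finite index set and let r_j ∈ (0,1) for each j ∈ B with ∑_{j∈B} r_j > 1. Then there exists exactly one vector ξ = (ξ_j)_{j∈B} with ξ_j ∈ (0,1) for all j ∈ B satisfying the system ξ_i = (1 - r_i) + r_i ∏_{j∈B} ξ_j for every i ∈ B. -/
/-- For `r j ∈ (0,1)`, the function `s ↦ (1 - ∏ j ∈ B, (1 - r j * s)) / s` is antitone on `(0,1]`;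
stated without division. -/
theorem mul_one_sub_prod_le {ι : Type*} (B : Finset ι) (r : ι → ℝ)
    (hr : ∀ j ∈ B, r j ∈ Set.Ioo (0 : ℝ) 1) {s t : ℝ} (hs : 0 < s) (hst : s < t) (ht : t ≤ 1) :
    s * (1 - ∏ j ∈ B, (1 - r j * t)) ≤ t * (1 - ∏ j ∈ B, (1 - r j * s)) := by
  classical
  induction B using Finset.induction_on with
  | empty => simp
  | insert a B ha ih =>
    have hrB : ∀ j ∈ B, r j ∈ Set.Ioo (0 : ℝ) 1 := fun j hj => hr j (Finset.mem_insert_of_mem hj)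
    have hle : ∏ j ∈ B, (1 - r j * t) ≤ ∏ j ∈ B, (1 - r j * s) := by
      refine Finset.prod_le_prod (fun j hj => ?_) fun j hj => ?_ <;>
        obtain ⟨h0, h1⟩ := hrB j hj <;> nlinarith
    have ih := ih hrB
    obtain ⟨ha0, -⟩ := hr a (Finset.mem_insert_self a B)
    rw [Finset.prod_insert ha, Finset.prod_insert ha]
    have := mul_le_mul_of_nonneg_left hle (mul_pos (mul_pos hs (hs.trans hst)) ha0).le
    linarith

/-- Strict version of `mul_one_sub_prod_le` for index sets with at least two elements. -/
theorem mul_one_sub_prod_lt {ι : Type*} (B : Finset ι) (hB : B.Nontrivial) (r : ι → ℝ)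
    (hr : ∀ j ∈ B, r j ∈ Set.Ioo (0 : ℝ) 1) {s t : ℝ} (hs : 0 < s) (hst : s < t) (ht : t ≤ 1) :
    s * (1 - ∏ j ∈ B, (1 - r j * t)) < t * (1 - ∏ j ∈ B, (1 - r j * s)) := by
  classical
  obtain ⟨a, ha⟩ := hB.nonempty
  have hrB : ∀ j ∈ B.erase a, r j ∈ Set.Ioo (0 : ℝ) 1 := fun j hj =>
    hr j (Finset.mem_of_mem_erase hj)
  have hlt : ∏ j ∈ B.erase a, (1 - r j * t) < ∏ j ∈ B.erase a, (1 - r j * s) := by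
    refine Finset.prod_lt_prod_of_nonempty (fun j hj => ?_) (fun j hj => ?_)
      (hB.erase_nonempty) <;> obtain ⟨h0, h1⟩ := hrB j hj <;> nlinarith
  have hle := mul_one_sub_prod_le (B.erase a) r hrB hs hst ht
  obtain ⟨ha0, -⟩ := hr a ha
  rw [← Finset.mul_prod_erase B _ ha, ← Finset.mul_prod_erase B (fun j => 1 - r j * s) ha]
  have := mul_lt_mul_of_pos_left hlt (mul_pos (mul_pos hs (hs.trans hst)) ha0)
  linarith

/-- If `∑ j ∈ B, r j > 1`, the equation `∏ j ∈ B, (1 - r j * s) = 1 - s` has a root in `(0,1)`. -/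
theorem exists_prod_one_sub_mul_eq {ι : Type*} (B : Finset ι) (r : ι → ℝ)
    (hr : ∀ j ∈ B, r j ∈ Set.Ioo (0 : ℝ) 1) (hsum : 1 < ∑ j ∈ B, r j) :
    ∃ s ∈ Set.Ioo (0 : ℝ) 1, ∏ j ∈ B, (1 - r j * s) = 1 - s := by
  obtain ⟨s, hs0, hs1, hs⟩ : ∃ s : ℝ, 0 < s ∧ s < 1 ∧ ∏ j ∈ B, (1 - r j * s) < 1 - s := by
    set R := ∑ j ∈ B, r j with hR
    have hR0 : 0 < R := by linarith
    obtain ⟨s, hs⟩ : ∃ s : ℝ, s * (2 * R) = R - 1 :=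
      ⟨(R - 1) / (2 * R), div_mul_cancel₀ _ (by positivity)⟩
    have hs0 : 0 < s := by
      by_contra! h
      nlinarith
    have hs1 : s < 1 := by nlinarith
    refine ⟨s, hs0, hs1, ?_⟩
    have hexp : ∏ j ∈ B, (1 - r j * s) ≤ Real.exp (-(R * s)) := by
      rw [hR, Finset.sum_mul, ← Finset.sum_neg_distrib, Real.exp_sum]
      refine Finset.prod_le_prod (fun j hj => ?_) fun j _ => Real.one_sub_le_exp_neg _
      obtain ⟨h0, h1⟩ := hr j hj
      nlinarith
    refine hexp.trans_lt ?_
    have hRs : 0 < R * s := mul_pos hR0 hs0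
    have h1 : R * s + 1 ≤ Real.exp (R * s) := Real.add_one_le_exp _
    rw [Real.exp_neg, inv_lt_iff_one_lt_mul₀ (Real.exp_pos _)]
    have h2 : (1 - s) * (R * s + 1) ≤ (1 - s) * Real.exp (R * s) :=
      mul_le_mul_of_nonneg_left h1 (by linarith)
    have h3 : (1 - s) * (R * s + 1) = 1 + s * (R - 1) / 2 := by
      linear_combination (-s / 2) * hs
    have h4 : 0 < s * (R - 1) := mul_pos hs0 (by linarith)
    linarith
  have hpos : 0 < ∏ j ∈ B, (1 - r j * 1) :=
    Finset.prod_pos fun j hj => by linarith [(hr j hj).2]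
  have hcont : ContinuousOn (fun s : ℝ => ∏ j ∈ B, (1 - r j * s) - (1 - s)) (Set.Icc s 1) := by
    fun_prop
  obtain ⟨u, hu, hu'⟩ := intermediate_value_Ioo hs1.le hcont
    (show (0 : ℝ) ∈ Set.Ioo _ _ from ⟨by linarith, by linarith⟩)
  exact ⟨u, ⟨hs0.trans hu.1, hu.2⟩, sub_eq_zero.1 hu'⟩


/-- For a nonempty finite sibling group `B` with `r j ∈ (0,1)` and `∑ j ∈ B, r j > 1`,
there is exactly one vector `ξ` with all components in `(0,1)` satisfying the system
`ξ i = (1 - r i) + r i * ∏ j ∈ B, ξ j` for every `i ∈ B`. -/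
theorem unique_solution_of_coupled_system {ι : Type*} (B : Finset ι) (hB : B.Nonempty)
    (r : ι → ℝ) (hr : ∀ j ∈ B, r j ∈ Set.Ioo (0 : ℝ) 1)
    (hsum : 1 < ∑ j ∈ B, r j) :
    ∃ ξ : ι → ℝ, (∀ j ∈ B, ξ j ∈ Set.Ioo (0 : ℝ) 1) ∧
      (∀ i ∈ B, ξ i = (1 - r i) + r i * ∏ j ∈ B, ξ j) ∧
      ∀ ξ' : ι → ℝ, (∀ j ∈ B, ξ' j ∈ Set.Ioo (0 : ℝ) 1) →
        (∀ i ∈ B, ξ' i = (1 - r i) + r i * ∏ j ∈ B, ξ' j) →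
        ∀ j ∈ B, ξ' j = ξ j := by
  have hnt : B.Nontrivial := by
    refine hB.exists_eq_singleton_or_nontrivial.resolve_left ?_
    rintro ⟨a, rfl⟩
    linarith [(hr a (by simp)).2, Finset.sum_singleton r a]
  obtain ⟨s, ⟨hs0, hs1⟩, hs⟩ := exists_prod_one_sub_mul_eq B r hr hsum
  refine ⟨fun j => 1 - r j * s, fun j hj => ?_, fun i _ => ?_, fun ξ hξ hsys => ?_⟩
  · obtain ⟨h0, h1⟩ := hr j hj
    constructor <;> nlinarith
  · rw [hs]
    ring
  · obtain ⟨p, hp⟩ : ∃ p, p = ∏ j ∈ B, ξ j := ⟨_, rfl⟩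
    have hp0 : 0 < p := hp ▸ Finset.prod_pos fun j hj => (hξ j hj).1
    have hξp : ∀ j ∈ B, ξ j = 1 - r j * (1 - p) := fun j hj => by
      rw [hsys j hj, ← hp]
      ring
    have hp1 : p < 1 := by
      obtain ⟨j, hj⟩ := hB
      have h := (hξ j hj).2
      rw [hξp j hj] at h
      have := pos_of_mul_pos_right (show 0 < r j * (1 - p) by linarith) (hr j hj).1.le
      linarith
    have ht : ∏ j ∈ B, (1 - r j * (1 - p)) = p :=
      (Finset.prod_congr rfl hξp).symm.trans hp.symm
    have hps : 1 - p = s := by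
      rcases lt_trichotomy (1 - p) s with h | h | h
      · have := mul_one_sub_prod_lt B hnt r hr (by linarith) h hs1.le
        rw [hs, ht] at this
        linarith
      · exact h
      · have := mul_one_sub_prod_lt B hnt r hr hs0 h (by linarith)
        rw [hs, ht] at this
        linarith
    intro j hj
    rw [hξp j hj, hps]
end
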